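/- arXiv:2403.15561 — 2 statements merged into one kernel-verified Lean document; each statement's English description precedes it below -/
import Mathlib

section
/- Let F be a field and m ≥ 1 an integer. For every matrix x ∈ M_{2m}(F), setting a = x + σ(x), where σ(x) = J⁻¹ · xᵀ · J is the standard symplectic involution, there exists a unique monic polynomial p ∈ F[X] of degree m such that p² equals the characteristic polynomial of a. (Existence and uniqueness of the reduced Pfaffian characteristic polynomial of a symmetrized element, in the split case.) -/
open Polynomial Matrix

/-- The standard symplectic matrix: block diagonal with `m` copies of `[[0,1],[-1,0]]`. -/
def sympJ (F : Type*) [Field F] (m : ℕ) : Matrix (Fin (2 * m)) (Fin (2 * m)) F :=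
  Matrix.of fun i j =>
    if i.val % 2 = 0 ∧ j.val = i.val + 1 then (1 : F)
    else if i.val % 2 = 1 ∧ i.val = j.val + 1 then (-1 : F)
    else 0

/-- The standard symplectic involution `σ(x) = J⁻¹ * xᵀ * J` on `M_{2m}(F)`. -/
noncomputable def sympInv (F : Type*) [Field F] (m : ℕ)
    (x : Matrix (Fin (2 * m)) (Fin (2 * m)) F) : Matrix (Fin (2 * m)) (Fin (2 * m)) F :=
  (sympJ F m)⁻¹ * xᵀ * sympJ F m

theorem sympJ_transpose (F : Type*) [Field F] (m : ℕ) : (sympJ F m)ᵀ = -sympJ F m := by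
  ext i j
  simp only [sympJ, Matrix.transpose_apply, Matrix.neg_apply, Matrix.of_apply]
  split_ifs <;> first | omega | simp

theorem sympJ_diag (F : Type*) [Field F] (m : ℕ) (i : Fin (2 * m)) : sympJ F m i i = 0 := by
  simp only [sympJ, Matrix.of_apply]
  split_ifs <;> first | omega | rfl

theorem sympJ_mul_self (F : Type*) [Field F] (m : ℕ) : sympJ F m * sympJ F m = -1 := by
  ext i j
  have hi := i.isLt
  have hj := j.isLt
  let k : Fin (2 * m) := if h : i.val % 2 = 0 then ⟨i.val + 1, by omega⟩ else ⟨i.val - 1, by omega⟩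
  have hk : k.val = if i.val % 2 = 0 then i.val + 1 else i.val - 1 := by
    simp only [k]; split_ifs <;> rfl
  rw [Matrix.mul_apply, Finset.sum_eq_single k]
  · simp only [sympJ, Matrix.of_apply, Matrix.neg_apply, Matrix.one_apply, Fin.ext_iff]
    split_ifs at hk ⊢ <;> first | omega | simp
  · intro l _ hl
    rw [Ne, Fin.ext_iff] at hl
    suffices h : sympJ F m i l = 0 by rw [h, zero_mul]
    simp only [sympJ, Matrix.of_apply]
    split_ifs at hk ⊢ <;> first | omega | rfl
  · simp

theorem isUnit_det_sympJ (F : Type*) [Field F] (m : ℕ) : IsUnit (sympJ F m).det := by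
  have h : sympJ F m * -sympJ F m = 1 := by rw [mul_neg, sympJ_mul_self, neg_neg]
  exact Matrix.isUnit_det_of_right_inverse h

/-- The determinant of an alternating matrix over a field is a square. -/
theorem isSquare_det_of_alternating {K : Type*} [Field K] :
    ∀ (n : ℕ) (A : Matrix (Fin n) (Fin n) K), Aᵀ = -A → (∀ i, A i i = 0) → IsSquare A.det
  | 0, A, _, _ => by simp
  | 1, A, _, hd => by simp [hd]
  | n + 2, A, ht, hd => by
    by_cases hrow : ∀ j, A 0 j = 0
    · rw [Matrix.det_eq_zero_of_row_eq_zero 0 hrow]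
      exact IsSquare.zero
    push Not at hrow
    obtain ⟨j, hj⟩ := hrow
    have hj0 : j ≠ 0 := by rintro rfl; exact hj (hd 0)
    have hskew : ∀ i k, A i k = -A k i := fun i k => by
      simpa using congrFun (congrFun ht k) i
    let e : Fin 2 ⊕ Fin n ≃ Fin (n + 2) :=
      (finSumFinEquiv.trans (finCongr (add_comm 2 n))).trans (Equiv.swap 1 j)
    have he0 : e (Sum.inl 0) = 0 := by
      change Equiv.swap 1 j 0 = 0
      exact Equiv.swap_apply_of_ne_of_ne (by simp) hj0.symm
    have he1 : e (Sum.inl 1) = j := Equiv.swap_apply_left 1 j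
    have hcorner : (A.submatrix e e).toBlocks₁₁ = !![0, A 0 j; -A 0 j, 0] := by
      ext p q
      fin_cases p <;> fin_cases q <;>
        simp [Matrix.toBlocks₁₁, he0, he1, hd, hskew j 0]
    let B := (A.submatrix e e).toBlocks₁₂
    let C := (A.submatrix e e).toBlocks₂₁
    let D := (A.submatrix e e).toBlocks₂₂
    let : Invertible !![0, A 0 j; -A 0 j, 0] :=
      ⟨!![0, -(A 0 j)⁻¹; (A 0 j)⁻¹, 0], by simp [hj, Matrix.one_fin_two],
        by simp [hj, Matrix.one_fin_two]⟩
    have hS : IsSquare (D - C * ⅟ !![0, A 0 j; -A 0 j, 0] * B).det := by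
      have hCB : ∀ k p, C k p = -B p k := fun k p => hskew _ _
      have hD : ∀ k l, D k l = -D l k := fun k l => hskew _ _
      have hDd : ∀ k, D k k = 0 := fun k => hd _
      have hinv : ⅟ !![0, A 0 j; -A 0 j, 0] = !![0, -(A 0 j)⁻¹; (A 0 j)⁻¹, 0] := rfl
      rw [hinv]
      refine isSquare_det_of_alternating n _ ?_ fun k => ?_
      · ext k l
        simp only [Matrix.transpose_apply, Matrix.neg_apply, Matrix.sub_apply, Matrix.mul_apply,
          Fin.sum_univ_two, hCB]
        rw [hD l k]
        simp
        ring
      · simp only [Matrix.sub_apply, Matrix.mul_apply, Fin.sum_univ_two, hCB, hDd]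
        simp
        ring
    rw [← Matrix.det_submatrix_equiv_self e A, ← Matrix.fromBlocks_toBlocks (A.submatrix e e),
      hcorner, Matrix.det_fromBlocks₁₁]
    refine IsSquare.mul ⟨A 0 j, ?_⟩ hS
    simp [Matrix.det_fin_two]

/-- The determinant of an alternating matrix over an integrally closed domain is a square. -/
theorem isSquare_det_of_alternating_of_isIntegrallyClosed {R : Type*} [CommRing R] [IsDomain R]
    [IsIntegrallyClosed R] {n : ℕ} (A : Matrix (Fin n) (Fin n) R) (ht : Aᵀ = -A)
    (hd : ∀ i, A i i = 0) : IsSquare A.det := by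
  let f := algebraMap R (FractionRing R)
  have hsq : IsSquare (A.map f).det := by
    refine isSquare_det_of_alternating n _ ?_ fun i => by simp [hd]
    rw [← Matrix.transpose_map, ht]
    ext
    simp
  obtain ⟨r, hr⟩ := hsq
  have hdet : f A.det = r * r := by rw [← hr, RingHom.map_det, RingHom.mapMatrix_apply]
  obtain ⟨q, rfl⟩ := IsIntegrallyClosed.exists_algebraMap_eq_of_isIntegral_pow (R := R)
    (K := FractionRing R) (x := r) two_pos (by rw [sq, ← hdet]; exact isIntegral_algebraMap)
  exact ⟨q, IsFractionRing.injective R (FractionRing R) (by rw [map_mul]; exact hdet)⟩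

/-- The characteristic polynomial of a symmetrized element is a square. -/
theorem isSquare_charpoly_add_sympInv (F : Type*) [Field F] (m : ℕ)
    (x : Matrix (Fin (2 * m)) (Fin (2 * m)) F) : IsSquare (x + sympInv F m x).charpoly := by
  obtain ⟨d, hdet⟩ := isSquare_det_of_alternating _ _ (sympJ_transpose F m) (sympJ_diag F m)
  have hd0 : d ≠ 0 := by
    rintro rfl
    exact (isUnit_det_sympJ F m).ne_zero (by simpa using hdet)
  set J := sympJ F m with hJ
  have hmul : J * (x + sympInv F m x) = J * x - (J * x)ᵀ := by
    rw [sympInv, mul_add, mul_assoc, Matrix.mul_nonsing_inv_cancel_left _ _ (isUnit_det_sympJ F m),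
      Matrix.transpose_mul, hJ, sympJ_transpose, mul_neg, sub_neg_eq_add]
  have hM : J.map C * (x + sympInv F m x).charmatrix =
      (X : F[X]) • J.map C - (J * x - (J * x)ᵀ).map C := by
    rw [← hmul, Matrix.charmatrix, mul_sub, RingHom.mapMatrix_apply, Matrix.map_mul]
    congr 1
    rw [← Matrix.scalar_commute _ (fun _ => Commute.all _ _), Matrix.smul_eq_diagonal_mul]
    rfl
  obtain ⟨q, hq⟩ := isSquare_det_of_alternating_of_isIntegrallyClosed
    (J.map C * (x + sympInv F m x).charmatrix)
    (by
      rw [hM]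
      ext1 i k
      have := congrFun (congrFun (sympJ_transpose F m) i) k
      simp only [Matrix.transpose_apply, Matrix.neg_apply] at this
      simp [hJ, this, -Matrix.transpose_mul]
      ring)
    (fun i => by rw [hM]; simp [hJ, sympJ_diag, -Matrix.transpose_mul])
  have hC : (J.map C).det = C d * C d := by
    rw [← C_mul, ← hdet, RingHom.map_det, RingHom.mapMatrix_apply]
  rw [Matrix.det_mul, hC] at hq
  refine ⟨C d⁻¹ * q, ?_⟩
  have h1 : C d⁻¹ * C d = 1 := by rw [← C_mul, inv_mul_cancel₀ hd0, C_1]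
  calc (x + sympInv F m x).charpoly
      = (C d⁻¹ * C d) * (C d⁻¹ * C d) * (x + sympInv F m x).charmatrix.det := by
        rw [h1, one_mul, one_mul]; rfl
    _ = C d⁻¹ * C d⁻¹ * (C d * C d * (x + sympInv F m x).charmatrix.det) := by ring
    _ = _ := by rw [hq]; ring

/-- A monic polynomial which is a square has a monic square root. -/
theorem exists_monic_sq_eq_of_isSquare {R : Type*} [CommRing R] [IsDomain R] {f : R[X]}
    (hf : f.Monic) (hsq : IsSquare f) : ∃ p : R[X], p.Monic ∧ p ^ 2 = f := by
  obtain ⟨q, rfl⟩ := hsq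
  have hlead : q.leadingCoeff * q.leadingCoeff = 1 := by rw [← leadingCoeff_mul]; exact hf
  rcases mul_self_eq_one_iff.mp hlead with h | h
  · exact ⟨q, h, sq q⟩
  · exact ⟨-q, by rw [Monic, leadingCoeff_neg, h, neg_neg], by ring⟩

/-- A monic polynomial over a domain is determined by its square. -/
theorem eq_of_monic_of_sq_eq_sq {R : Type*} [CommRing R] [IsDomain R] {p q : R[X]}
    (hp : p.Monic) (hq : q.Monic) (h : p ^ 2 = q ^ 2) : p = q := by
  rcases sq_eq_sq_iff_eq_or_eq_neg.mp h with h | h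
  · exact h
  · have hone : (1 : R) = -1 := by
      simpa [hp.leadingCoeff, hq.leadingCoeff] using congrArg leadingCoeff h
    calc p = C (-1) * q := by rw [h, C_neg, C_1, neg_one_mul]
      _ = q := by rw [← hone, C_1, one_mul]

/-- Existence and uniqueness of the reduced Pfaffian characteristic polynomial of a
symmetrized element `a = x + σ(x)`, in the split case. -/
theorem stmt0 (F : Type*) [Field F] (m : ℕ) (hm : 1 ≤ m)
    (x : Matrix (Fin (2 * m)) (Fin (2 * m)) F) :
    ∃! p : F[X], p.Monic ∧ p.natDegree = m ∧
      p ^ 2 = (x + sympInv F m x).charpoly := by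
  have hmonic := (x + sympInv F m x).charpoly_monic
  obtain ⟨p, hp, hsq⟩ := exists_monic_sq_eq_of_isSquare hmonic (isSquare_charpoly_add_sympInv F m x)
  refine ⟨p, ⟨hp, ?_, hsq⟩, fun q hq => eq_of_monic_of_sq_eq_sq hq.1 hp (hq.2.2.trans hsq.symm)⟩
  have hdeg := (x + sympInv F m x).charpoly_natDegree_eq_dim
  rw [← hsq, natDegree_pow, Fintype.card_fin] at hdeg
  omega
end

section
/- Let F be a field and m ≥ 2 an integer such that (m−1)·1 ≠ 0 in F (i.e. the characteristic of F does not divide m−1). If a ∈ Symd(σ) ⊆ M_{2m}(F) satisfies Srp(a+b) = Srp(a) + Srp(b) for every b ∈ Symd(σ), then a = 0. In other words, the polar form of the quadratic map Srp on Symd(σ) is nondegenerate. (Split-matrix case of the nondegeneracy corollary.) -/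
open Polynomial Matrix Classical

/-- The reduced Pfaffian polynomial of `a ∈ Symd(σ)`: the unique monic polynomial of
degree `m` whose square is the characteristic polynomial of `a` (junk value `0` if no
such polynomial exists). -/
noncomputable def Prp (F : Type*) [Field F] (m : ℕ)
    (a : Matrix (Fin (2 * m)) (Fin (2 * m)) F) : F[X] :=
  if h : ∃ p : F[X], p.Monic ∧ p.natDegree = m ∧ p ^ 2 = a.charpoly then h.choose else 0

/-- `Srp(a)` is the coefficient of `X^(m-2)` in the reduced Pfaffian polynomial. -/
noncomputable def Srp (F : Type*) [Field F] (m : ℕ)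
    (a : Matrix (Fin (2 * m)) (Fin (2 * m)) F) : F :=
  (Prp F m a).coeff (m - 2)

namespace SympReduced

theorem isSquare_det_of_transpose_eq_neg {K : Type*} [Field K] (h2 : (2 : K) ≠ 0) {n : Type*}
    [Fintype n] [DecidableEq n] (A : Matrix n n K) (hA : Aᵀ = -A) : IsSquare A.det := by
  induction hN : Fintype.card n using Nat.strong_induction_on generalizing n with
  | _ N ih =>
  have hskew : ∀ i j, A j i = -A i j := fun i j => congrFun (congrFun hA i) j
  have hdiag : ∀ i, A i i = 0 := fun i => by
    have h : (2 : K) * A i i = 0 := by linear_combination hskew i i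
    exact (mul_eq_zero.mp h).resolve_left h2
  by_cases h0 : A = 0
  · subst h0
    rcases isEmpty_or_nonempty n with hn | hn
    · exact ⟨1, by simp⟩
    · exact ⟨0, by simp⟩
  obtain ⟨i, j, hij⟩ : ∃ i j, A i j ≠ 0 := by
    by_contra! h
    exact h0 (Matrix.ext h)
  have hne : i ≠ j := fun h => hij (h ▸ hdiag i)
  let p : n → Prop := fun k => k = i ∨ k = j
  let B : Matrix ({k // p k} ⊕ {k // ¬p k}) ({k // p k} ⊕ {k // ¬p k}) K :=
    A.submatrix (Equiv.sumCompl p) (Equiv.sumCompl p)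
  have hB : Bᵀ = -B := by
    ext k l
    exact hskew _ _
  have hBdet : B.det = A.det := Matrix.det_submatrix_equiv_self _ _
  let f : Fin 2 → {k // p k} := ![⟨i, Or.inl rfl⟩, ⟨j, Or.inr rfl⟩]
  have hf : Function.Bijective f := by
    constructor
    · intro k l h
      fin_cases k <;> fin_cases l <;> simp [f, hne, hne.symm] at h ⊢
    · rintro ⟨k, rfl | rfl⟩
      · exact ⟨0, rfl⟩
      · exact ⟨1, rfl⟩
  have hdet : B.toBlocks₁₁.det = A i j ^ 2 := by
    rw [← Matrix.det_submatrix_equiv_self (Equiv.ofBijective f hf), Matrix.det_fin_two]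
    have h00 : B.toBlocks₁₁ (f 0) (f 0) = A i i := rfl
    have h01 : B.toBlocks₁₁ (f 0) (f 1) = A i j := rfl
    have h10 : B.toBlocks₁₁ (f 1) (f 0) = A j i := rfl
    simp only [Matrix.submatrix_apply, Equiv.ofBijective_apply, h00, h01, h10, hdiag,
      hskew i j]
    ring
  have hunit : IsUnit B.toBlocks₁₁.det := by
    rw [hdet]
    exact (pow_ne_zero 2 hij).isUnit
  let _ : Invertible B.toBlocks₁₁ := Matrix.invertibleOfIsUnitDet _ hunit
  have h11 : B.toBlocks₁₁ᵀ = -B.toBlocks₁₁ := by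
    ext k l
    exact congrFun (congrFun hB (Sum.inl k)) (Sum.inl l)
  have h12 : B.toBlocks₁₂ᵀ = -B.toBlocks₂₁ := by
    ext k l
    exact congrFun (congrFun hB (Sum.inr k)) (Sum.inl l)
  have h21 : B.toBlocks₂₁ᵀ = -B.toBlocks₁₂ := by
    ext k l
    exact congrFun (congrFun hB (Sum.inl k)) (Sum.inr l)
  have h22 : B.toBlocks₂₂ᵀ = -B.toBlocks₂₂ := by
    ext k l
    exact congrFun (congrFun hB (Sum.inr k)) (Sum.inr l)
  have hinv : (-B.toBlocks₁₁)⁻¹ = -B.toBlocks₁₁⁻¹ := by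
    refine Matrix.inv_eq_right_inv ?_
    rw [neg_mul_neg, Matrix.mul_nonsing_inv _ hunit]
  have hcard : Fintype.card {k // ¬p k} < N := by
    rw [← hN]
    exact Fintype.card_subtype_lt (x := i) (not_not.mpr (Or.inl rfl))
  obtain ⟨c, hc⟩ := ih _ hcard
    (B.toBlocks₂₂ - B.toBlocks₂₁ * ⅟B.toBlocks₁₁ * B.toBlocks₁₂) (by
      rw [Matrix.invOf_eq_nonsing_inv, Matrix.transpose_sub, Matrix.transpose_mul,
        Matrix.transpose_mul, Matrix.transpose_nonsing_inv, h11, h12, h21, h22, hinv]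
      simp only [Matrix.neg_mul, Matrix.mul_neg, neg_neg, Matrix.mul_assoc]
      abel) rfl
  refine ⟨A i j * c, ?_⟩
  rw [← hBdet, ← Matrix.fromBlocks_toBlocks B, Matrix.det_fromBlocks₁₁, hdet, hc]
  ring

theorem two_mul_coeff_two_charpolyRev {R : Type*} [CommRing R] {n : Type*} [Fintype n] [DecidableEq n]
    (M : Matrix n n R) :
    2 * M.charpolyRev.coeff 2 = M.trace ^ 2 - (M * M).trace := by
  have hprod : M.charpolyRev * (-M).charpolyRev = Polynomial.expand R 2 (M * M).charpolyRev := by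
    have hmap : Polynomial.expand R 2 (M * M).charpolyRev
        = Matrix.det (1 - (X ^ 2 : R[X]) • (M * M).map C) := by
      generalize M * M = N
      rw [Matrix.charpolyRev, AlgHom.map_det]
      congr 1
      ext i j : 2
      by_cases h : i = j <;> simp [h]
    rw [hmap, Matrix.charpolyRev, Matrix.charpolyRev, ← Matrix.det_mul]
    congr 1
    have : (-M).map (C : R →+* R[X]) = -(M.map C) := by ext; simp
    rw [this, Matrix.map_mul]
    simp only [smul_neg, sub_neg_eq_add, sub_mul, mul_add, one_mul, mul_one, Matrix.smul_mul,
      Matrix.mul_smul, smul_smul, pow_two]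
    abel
  have hneg : (-M).charpolyRev = M.charpolyRev.comp (-X) := by
    rw [← Polynomial.coe_compRingHom_apply, Matrix.charpolyRev, Matrix.charpolyRev,
      RingHom.map_det]
    congr 1
    ext i j : 2
    by_cases h : i = j <;> simp [h]
  have hc := congrArg (fun q => q.coeff 2) hprod
  have h0 : ∀ N : Matrix n n R, N.charpolyRev.coeff 0 = 1 := fun N => by
    rw [Polynomial.coeff_zero_eq_eval_zero, Matrix.eval_charpolyRev]
  have h2 : (-M).charpolyRev.coeff 2 = M.charpolyRev.coeff 2 := by
    rw [hneg, show (-X : R[X]) = C (-1) * X by simp, Polynomial.comp_C_mul_X_coeff]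
    simp
  have he : (Polynomial.expand R 2 (M * M).charpolyRev).coeff 2 = (M * M).charpolyRev.coeff 1 := by
    simpa using Polynomial.coeff_expand_mul (p := 2) (by norm_num) (M * M).charpolyRev 1
  simp only [Polynomial.coeff_mul, Finset.Nat.antidiagonal_succ, he,
    Matrix.coeff_charpolyRev_eq_neg_trace] at hc
  simp [h0, h2] at hc
  linear_combination hc

theorem exists_monic_sq_eq_charpoly {R : Type*} [CommRing R] [IsDomain R]
    [UniqueFactorizationMonoid R] (h2 : (2 : R) ≠ 0) {m : ℕ}
    (J a : Matrix (Fin (2 * m)) (Fin (2 * m)) R) (hJt : Jᵀ = -J) (hJ : J * J = -1)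
    (ha : aᵀ * J = J * a) :
    ∃ p : R[X], p.Monic ∧ p.natDegree = m ∧ p ^ 2 = a.charpoly := by
  let K := FractionRing R[X]
  let f : R[X] →+* K := algebraMap R[X] K
  have hf : Function.Injective f := IsFractionRing.injective R[X] K
  have h2K : (2 : K) ≠ 0 := by
    have h : f (C 2) ≠ 0 := (map_ne_zero_iff f hf).mpr (by simpa using h2)
    rwa [map_ofNat, map_ofNat] at h
  let J' : Matrix (Fin (2 * m)) (Fin (2 * m)) R[X] := J.map C
  have hJ't : J'ᵀ = -J' := by
    ext i j : 2
    have h : J j i = -J i j := congrFun (congrFun hJt i) j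
    simp [J', h]
  have hM : (J' * a.charmatrix)ᵀ = -(J' * a.charmatrix) := by
    have hc : (J * a).map (C : R →+* R[X]) = (aᵀ * J).map C := by rw [ha]
    have e : J' * a.charmatrix = (X : R[X]) • J' - (J * a).map C := by
      rw [Matrix.charmatrix, mul_sub, Matrix.map_mul]
      simp [J', Matrix.scalar_apply, Matrix.smul_eq_mul_diagonal]
    have e' : ((J * a).map (C : R →+* R[X]))ᵀ = -(J * a).map C := by
      rw [← Matrix.transpose_map, Matrix.transpose_mul, hJt, mul_neg, ha]
      generalize J * a = N
      ext; simp
    rw [e, Matrix.transpose_sub, Matrix.transpose_smul, hJ't, e']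
    simp only [smul_neg]
    abel
  have hsq : ∀ A : Matrix (Fin (2 * m)) (Fin (2 * m)) R[X], Aᵀ = -A → IsSquare (f A.det) := by
    intro A hA
    rw [RingHom.map_det]
    refine isSquare_det_of_transpose_eq_neg h2K _ ?_
    ext i j
    simpa using congrArg f (congrFun (congrFun hA i) j)
  obtain ⟨d, hd⟩ := hsq _ hJ't
  obtain ⟨s, hs⟩ := hsq _ hM
  have hJ'det : J'.det ≠ 0 := by
    have h : J'.det * J'.det = 1 := by
      rw [← Matrix.det_mul, ← Matrix.map_mul, hJ]
      have : (-1 : Matrix (Fin (2 * m)) (Fin (2 * m)) R).map (C : R →+* R[X]) = -1 := by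
        ext i j : 2
        by_cases h : i = j <;> simp [h]
      rw [this, Matrix.det_neg]
      simp
    exact left_ne_zero_of_mul_eq_one h
  have hd0 : d ≠ 0 := by
    rintro rfl
    exact hJ'det (hf (by simpa using hd))
  have hquot : (s / d) ^ 2 = f a.charpoly := by
    rw [Matrix.det_mul, map_mul, hd] at hs
    rw [Matrix.charpoly, div_pow, div_eq_iff (pow_ne_zero 2 hd0)]
    linear_combination -hs
  obtain ⟨p, hp⟩ := IsIntegrallyClosed.exists_algebraMap_eq_of_isIntegral_pow (R := R[X])
    (x := s / d) (n := 2) two_pos (hquot ▸ isIntegral_algebraMap)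
  have hp2 : p ^ 2 = a.charpoly := hf (by rw [map_pow, ← hquot]; exact congrArg (· ^ 2) hp)
  have hdeg : p.natDegree = m := by
    have h := congrArg Polynomial.natDegree hp2
    rw [Polynomial.natDegree_pow, Matrix.charpoly_natDegree_eq_dim, Fintype.card_fin] at h
    omega
  have hlead : p.leadingCoeff ^ 2 = 1 := by
    rw [← Polynomial.leadingCoeff_pow, hp2]
    exact a.charpoly_monic
  rcases sq_eq_one_iff.mp hlead with h | h
  · exact ⟨p, h, hdeg, hp2⟩
  · exact ⟨-p, by simp [Polynomial.Monic, h], by simpa using hdeg, by simpa using hp2⟩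

theorem coeff_of_sq_eq_charpoly {R : Type*} [CommRing R] [IsDomain R] {m : ℕ} (hm : 2 ≤ m)
    (a : Matrix (Fin (2 * m)) (Fin (2 * m)) R) {p : R[X]} (hp : p.Monic)
    (hdeg : p.natDegree = m) (hsq : p ^ 2 = a.charpoly) :
    2 * p.coeff (m - 1) = -a.trace ∧
      4 * p.coeff (m - 2) + 2 * p.coeff (m - 1) ^ 2 = a.trace ^ 2 - (a * a).trace := by
  have hrev : p.reverse * p.reverse = a.charpolyRev := by
    rw [← Matrix.reverse_charpoly, ← hsq, pow_two, Polynomial.reverse_mul_of_domain]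
  have h0 : p.reverse.coeff 0 = 1 := by simpa using hp.leadingCoeff
  have h1 : p.reverse.coeff 1 = p.coeff (m - 1) := by
    rw [Polynomial.coeff_reverse, hdeg, Polynomial.revAt_le (by omega)]
  have h2 : p.reverse.coeff 2 = p.coeff (m - 2) := by
    rw [Polynomial.coeff_reverse, hdeg, Polynomial.revAt_le (by omega)]
  have c1 := congrArg (fun q => q.coeff 1) hrev
  have c2 := congrArg (fun q => q.coeff 2) hrev
  simp only [Polynomial.coeff_mul, Finset.Nat.antidiagonal_succ,
    Matrix.coeff_charpolyRev_eq_neg_trace] at c1 c2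
  simp [h1, h2, hp.leadingCoeff] at c1 c2
  have := two_mul_coeff_two_charpolyRev a
  constructor
  · linear_combination c1
  · linear_combination 2 * c2 + this

theorem Monic.eq_of_sq_eq_sq {R : Type*} [CommRing R] [IsDomain R] {p q : R[X]} (hp : p.Monic)
    (hq : q.Monic) (h : p ^ 2 = q ^ 2) : p = q := by
  rcases sq_eq_sq_iff_eq_or_eq_neg.mp h with h | h
  · exact h
  · have h1 : (1 : R) = -1 := by
      have := congrArg Polynomial.leadingCoeff h
      rwa [Polynomial.leadingCoeff_neg, hp.leadingCoeff, hq.leadingCoeff] at this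
    calc p = C (-1) * q := by rw [h]; simp
      _ = q := by rw [← h1]; simp

theorem Prp_eq {F : Type*} [Field F] {m : ℕ} {a : Matrix (Fin (2 * m)) (Fin (2 * m)) F}
    {p : F[X]} (hp : p.Monic) (hdeg : p.natDegree = m) (hsq : p ^ 2 = a.charpoly) :
    Prp F m a = p := by
  have h : ∃ p : F[X], p.Monic ∧ p.natDegree = m ∧ p ^ 2 = a.charpoly := ⟨p, hp, hdeg, hsq⟩
  rw [Prp, dif_pos h]
  exact Monic.eq_of_sq_eq_sq h.choose_spec.1 hp (h.choose_spec.2.2.trans hsq.symm)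

/-- The integral form of the standard symplectic matrix. -/
def intJ (m : ℕ) : Matrix (Fin (2 * m)) (Fin (2 * m)) ℤ :=
  Matrix.of fun i j =>
    if i.val % 2 = 0 ∧ j.val = i.val + 1 then 1
    else if i.val % 2 = 1 ∧ i.val = j.val + 1 then -1
    else 0

theorem intJ_transpose (m : ℕ) : (intJ m)ᵀ = -intJ m := by
  ext i j
  simp only [intJ, Matrix.transpose_apply, Matrix.of_apply, Matrix.neg_apply]
  split_ifs <;> omega

theorem intJ_mul_self (m : ℕ) : intJ m * intJ m = -1 := by
  ext i k
  rw [Matrix.mul_apply, Matrix.neg_apply, Matrix.one_apply]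
  have hi := i.isLt
  have hp : (if i.val % 2 = 0 then i.val + 1 else i.val - 1) < 2 * m := by
    split_ifs <;> omega
  rw [Finset.sum_eq_single ⟨_, hp⟩]
  · simp only [intJ, Matrix.of_apply, Fin.ext_iff]
    split_ifs <;> omega
  · intro j _ hj
    simp only [ne_eq, Fin.ext_iff] at hj
    have : intJ m i j = 0 := by
      simp only [intJ, Matrix.of_apply]
      split_ifs at hj ⊢ <;> omega
    rw [this, zero_mul]
  · simp

theorem intJ_map (F : Type*) [Field F] (m : ℕ) : (intJ m).map (Int.castRingHom F) = sympJ F m := by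
  ext i j
  simp only [intJ, sympJ, Matrix.map_apply, Matrix.of_apply]
  split_ifs <;> simp

section

variable {R : Type*} [CommRing R] {n : Type*} [Fintype n]

/-- The symmetrized element `x + J⁻¹ xᵀ J` for `J` with `J⁻¹ = -J`. -/
def symd (J x : Matrix n n R) : Matrix n n R :=
  x - J * xᵀ * J

theorem symd_add (J x y : Matrix n n R) : symd J (x + y) = symd J x + symd J y := by
  simp only [symd, Matrix.transpose_add, mul_add, add_mul]
  abel

theorem symd_map {S : Type*} [CommRing S] (f : R →+* S) (J x : Matrix n n R) :
    (symd J x).map f = symd (J.map f) (x.map f) := by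
  rw [symd, symd, ← Matrix.transpose_map, ← Matrix.map_mul, ← Matrix.map_mul,
    Matrix.map_sub f (map_sub f)]

variable [DecidableEq n]

theorem transpose_symd_mul {J : Matrix n n R} (hJt : Jᵀ = -J) (hJ : J * J = -1)
    (x : Matrix n n R) : (symd J x)ᵀ * J = J * symd J x := by
  simp only [symd, Matrix.transpose_sub, Matrix.transpose_mul, Matrix.transpose_transpose, hJt,
    sub_mul, mul_sub, neg_mul, mul_neg, neg_neg]
  rw [show J * (x * J) * J = J * x * (J * J) by noncomm_ring,
    show J * (J * xᵀ * J) = J * J * (xᵀ * J) by noncomm_ring, hJ]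
  simp only [mul_neg, neg_mul, mul_one, one_mul]
  abel

theorem trace_symd {J : Matrix n n R} (hJ : J * J = -1) (x : Matrix n n R) :
    (symd J x).trace = 2 * x.trace := by
  rw [symd, Matrix.trace_sub, Matrix.trace_mul_comm, ← mul_assoc, hJ, neg_mul, one_mul,
    Matrix.trace_neg, Matrix.trace_transpose]
  ring

theorem trace_symd_mul_symd {J : Matrix n n R} (hJt : Jᵀ = -J) (hJ : J * J = -1)
    (x y : Matrix n n R) :
    (symd J x * symd J y).trace = 2 * (symd J x * y).trace := by
  have h : (symd J x * (J * yᵀ * J)).trace = -(symd J x * y).trace := by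
    rw [← mul_assoc, Matrix.trace_mul_comm, ← mul_assoc, ← mul_assoc,
      ← transpose_symd_mul hJt hJ, mul_assoc _ J J, hJ, mul_neg, mul_one, neg_mul,
      Matrix.trace_neg, ← Matrix.transpose_mul, Matrix.trace_transpose, Matrix.trace_mul_comm]
  rw [show symd J y = y - J * yᵀ * J from rfl, mul_sub, Matrix.trace_sub, h]
  ring

end

theorem coeff_symd {R : Type*} [CommRing R] [IsDomain R] (h2 : (2 : R) ≠ 0) {m : ℕ} (hm : 2 ≤ m)
    {J : Matrix (Fin (2 * m)) (Fin (2 * m)) R} (hJt : Jᵀ = -J) (hJ : J * J = -1)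
    (x : Matrix (Fin (2 * m)) (Fin (2 * m)) R) {p : R[X]} (hp : p.Monic)
    (hdeg : p.natDegree = m) (hsq : p ^ 2 = (symd J x).charpoly) :
    p.coeff (m - 1) = -x.trace ∧ 2 * p.coeff (m - 2) = x.trace ^ 2 - (symd J x * x).trace := by
  obtain ⟨h1, h4⟩ := coeff_of_sq_eq_charpoly hm _ hp hdeg hsq
  rw [trace_symd hJ] at h1 h4
  rw [trace_symd_mul_symd hJt hJ] at h4
  have h1' : p.coeff (m - 1) = -x.trace := mul_left_cancel₀ h2 (by linear_combination h1)
  refine ⟨h1', mul_left_cancel₀ h2 ?_⟩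
  rw [h1'] at h4
  linear_combination h4

theorem coeff_symd_add {R : Type*} [CommRing R] [IsDomain R] (h2 : (2 : R) ≠ 0) {m : ℕ}
    (hm : 2 ≤ m) {J : Matrix (Fin (2 * m)) (Fin (2 * m)) R} (hJt : Jᵀ = -J) (hJ : J * J = -1)
    (x y : Matrix (Fin (2 * m)) (Fin (2 * m)) R) {p q r : R[X]}
    (hp : p.Monic) (hpdeg : p.natDegree = m) (hpsq : p ^ 2 = (symd J x).charpoly)
    (hq : q.Monic) (hqdeg : q.natDegree = m) (hqsq : q ^ 2 = (symd J y).charpoly)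
    (hr : r.Monic) (hrdeg : r.natDegree = m) (hrsq : r ^ 2 = (symd J (x + y)).charpoly) :
    r.coeff (m - 2) =
      p.coeff (m - 2) + q.coeff (m - 2) + (x.trace * y.trace - (symd J x * y).trace) := by
  have hx := (coeff_symd h2 hm hJt hJ x hp hpdeg hpsq).2
  have hy := (coeff_symd h2 hm hJt hJ y hq hqdeg hqsq).2
  have hxy := (coeff_symd h2 hm hJt hJ (x + y) hr hrdeg hrsq).2
  have hsymm : (symd J y * x).trace = (symd J x * y).trace := mul_left_cancel₀ h2 <| by
    rw [← trace_symd_mul_symd hJt hJ, ← trace_symd_mul_symd hJt hJ, Matrix.trace_mul_comm]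
  rw [symd_add, add_mul, mul_add, mul_add, Matrix.trace_add, Matrix.trace_add, Matrix.trace_add,
    Matrix.trace_add, hsymm] at hxy
  refine mul_left_cancel₀ h2 ?_
  linear_combination hxy - hx - hy

theorem sympJ_transpose (F : Type*) [Field F] (m : ℕ) : (sympJ F m)ᵀ = -sympJ F m := by
  rw [← intJ_map, ← Matrix.transpose_map, intJ_transpose, Matrix.map_neg _ (map_neg _)]

theorem intJ_map_mul_self (R : Type*) [CommRing R] (m : ℕ) :
    (intJ m).map (Int.castRingHom R) * (intJ m).map (Int.castRingHom R) = -1 := by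
  rw [← Matrix.map_mul, intJ_mul_self, Matrix.map_neg _ (map_neg _),
    Matrix.map_one _ (map_zero _) (map_one _)]

theorem add_sympInv (F : Type*) [Field F] (m : ℕ) (x : Matrix (Fin (2 * m)) (Fin (2 * m)) F) :
    x + sympInv F m x = symd (sympJ F m) x := by
  have hinv : (sympJ F m)⁻¹ = -sympJ F m := Matrix.inv_eq_right_inv <| by
    rw [mul_neg, ← intJ_map, intJ_map_mul_self, neg_neg]
  rw [sympInv, symd, hinv, neg_mul, neg_mul, sub_eq_add_neg]

/-- The coefficients of the reduced Pfaffian polynomial, obtained by specializing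
generic matrices over `ℤ`. -/
theorem Prp_symd {F : Type*} [Field F] {m : ℕ} (hm : 2 ≤ m)
    (x y : Matrix (Fin (2 * m)) (Fin (2 * m)) F) :
    Prp F m (symd (sympJ F m) x) ^ 2 = (symd (sympJ F m) x).charpoly ∧
    (Prp F m (symd (sympJ F m) x)).Monic ∧
    (Prp F m (symd (sympJ F m) x)).coeff (m - 1) = -x.trace ∧
    Srp F m (symd (sympJ F m) x + symd (sympJ F m) y) =
      Srp F m (symd (sympJ F m) x) + Srp F m (symd (sympJ F m) y) +
        (x.trace * y.trace - (symd (sympJ F m) x * y).trace) := by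
  let R := MvPolynomial (Bool × Fin (2 * m) × Fin (2 * m)) ℤ
  let φ : R →+* F := MvPolynomial.eval₂Hom (Int.castRingHom F)
    fun k => bif k.1 then y k.2.1 k.2.2 else x k.2.1 k.2.2
  let gx : Matrix (Fin (2 * m)) (Fin (2 * m)) R :=
    Matrix.of fun i j => MvPolynomial.X (false, i, j)
  let gy : Matrix (Fin (2 * m)) (Fin (2 * m)) R :=
    Matrix.of fun i j => MvPolynomial.X (true, i, j)
  let J : Matrix (Fin (2 * m)) (Fin (2 * m)) R := (intJ m).map (Int.castRingHom R)
  have hgx : gx.map φ = x := by ext i j; exact MvPolynomial.eval₂_X _ _ _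
  have hgy : gy.map φ = y := by ext i j; exact MvPolynomial.eval₂_X _ _ _
  have hJφ : J.map φ = sympJ F m := by
    rw [← intJ_map]
    ext i j
    simp [J]
  have hJ : J * J = -1 := intJ_map_mul_self R m
  have hJt : Jᵀ = -J := by
    rw [← Matrix.transpose_map, intJ_transpose, Matrix.map_neg _ (map_neg _)]
  have h2 : (2 : R) ≠ 0 := two_ne_zero
  have hex := fun z => exists_monic_sq_eq_charpoly h2 J (symd J z) hJt hJ
    (transpose_symd_mul hJt hJ z)
  obtain ⟨p, hp, hpdeg, hpsq⟩ := hex gx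
  obtain ⟨q, hq, hqdeg, hqsq⟩ := hex gy
  obtain ⟨r, hr, hrdeg, hrsq⟩ := hex (gx + gy)
  have hspec : ∀ (z : Matrix (Fin (2 * m)) (Fin (2 * m)) R) (s : R[X]), s.Monic →
      s.natDegree = m → s ^ 2 = (symd J z).charpoly →
      (s.map φ) ^ 2 = (symd (sympJ F m) (z.map φ)).charpoly ∧
        Prp F m (symd (sympJ F m) (z.map φ)) = s.map φ := by
    intro z s hs hsdeg hssq
    have h : (s.map φ) ^ 2 = (symd (sympJ F m) (z.map φ)).charpoly := by
      rw [← Polynomial.map_pow, hssq, ← Matrix.charpoly_map, symd_map, hJφ]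
    exact ⟨h, Prp_eq (hs.map φ) ((hs.natDegree_map φ).trans hsdeg) h⟩
  obtain ⟨hpφ, hpP⟩ := hspec gx p hp hpdeg hpsq
  obtain ⟨-, hqP⟩ := hspec gy q hq hqdeg hqsq
  obtain ⟨-, hrP⟩ := hspec (gx + gy) r hr hrdeg hrsq
  have htr : ∀ z : Matrix (Fin (2 * m)) (Fin (2 * m)) R, φ z.trace = (z.map φ).trace :=
    fun z => AddMonoidHom.map_trace φ z
  rw [Matrix.map_add _ (map_add φ), hgx, hgy] at hrP
  rw [hgx] at hpφ hpP
  rw [hgy] at hqP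
  refine ⟨hpP ▸ hpφ, hpP ▸ hp.map φ, ?_, ?_⟩
  · rw [hpP, Polynomial.coeff_map, (coeff_symd h2 hm hJt hJ gx hp hpdeg hpsq).1, map_neg, htr, hgx]
  · rw [← symd_add, Srp, Srp, Srp, hpP, hqP, hrP, Polynomial.coeff_map, Polynomial.coeff_map,
      Polynomial.coeff_map, coeff_symd_add h2 hm hJt hJ gx gy hp hpdeg hpsq hq hqdeg hqsq
      hr hrdeg hrsq]
    simp only [map_add, map_sub, map_mul, htr, Matrix.map_mul, symd_map, hgx, hgy, hJφ]

end SympReduced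

/-- If the characteristic of `F` does not divide `m - 1` and `a ∈ Symd(σ)` satisfies
`Srp(a+b) = Srp(a) + Srp(b)` for every `b ∈ Symd(σ)`, then `a = 0`: the polar form of
`Srp` is nondegenerate. -/
theorem stmt3 (F : Type*) [Field F] (m : ℕ) (hm : 2 ≤ m)
    (hchar : ((m : F) - 1) ≠ 0)
    (a : Matrix (Fin (2 * m)) (Fin (2 * m)) F)
    (ha : ∃ x, a = x + sympInv F m x)
    (hadd : ∀ b : Matrix (Fin (2 * m)) (Fin (2 * m)) F,
      (∃ y, b = y + sympInv F m y) → Srp F m (a + b) = Srp F m a + Srp F m b) :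
    a = 0 := by
  obtain ⟨x, rfl⟩ := ha
  rw [SympReduced.add_sympInv] at hadd ⊢
  have htrace : ∀ y : Matrix (Fin (2 * m)) (Fin (2 * m)) F,
      (SympReduced.symd (sympJ F m) x * y).trace = (x.trace • 1 * y).trace := by
    intro y
    have h := hadd _ ⟨y, rfl⟩
    rw [SympReduced.add_sympInv, (SympReduced.Prp_symd hm x y).2.2.2] at h
    rw [Matrix.smul_mul, one_mul, Matrix.trace_smul, smul_eq_mul]
    linear_combination -h
  have hscalar : SympReduced.symd (sympJ F m) x = x.trace • 1 :=
    Matrix.ext_iff_trace_mul_right.mpr htrace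
  obtain ⟨hsq, hmonic, hcoeff, -⟩ := SympReduced.Prp_symd hm x 0
  have hchar' : (SympReduced.symd (sympJ F m) x).charpoly = ((X - C x.trace) ^ m) ^ 2 := by
    rw [hscalar, Matrix.smul_one_eq_diagonal, Matrix.charpoly_diagonal, Finset.prod_const,
      Finset.card_univ, Fintype.card_fin, ← pow_mul, mul_comm m 2]
  have hP := SympReduced.Monic.eq_of_sq_eq_sq hmonic ((monic_X_sub_C x.trace).pow m)
    (hsq.trans hchar')
  have hdeg : ((X - C x.trace) ^ m).natDegree = m := by simp
  have hnext : ((X - C x.trace) ^ m).coeff (m - 1) = m • (-x.trace) := by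
    rw [← Polynomial.nextCoeff_X_sub_C, ← (monic_X_sub_C x.trace).nextCoeff_pow,
      Polynomial.nextCoeff_of_natDegree_pos (by omega), hdeg]
  rw [hP, hnext, nsmul_eq_mul] at hcoeff
  have hzero : x.trace = 0 :=
    (mul_eq_zero.mp (show ((m : F) - 1) * x.trace = 0 by linear_combination -hcoeff)).resolve_left
      hchar
  rw [hscalar, hzero, zero_smul]
end
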